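/- arXiv:2208.03979 — 5 statements merged into one kernel-verified Lean document; each statement's English description precedes it below -/
import Mathlib

section
/- Let s = 2 and C := I_1 ∩ I_2. For a vector ν = (ν_k)_{k∈C} of new real variables define F_1(x^{(1)},ν) := ∇_1 f_1(x^{(1)}) + Σ_{k∈C} ν_k e^{(1)}_k ∈ ℝ^{n_1} and F_2(x^{(2)},ν) := ∇_2 f_2(x^{(2)}) − Σ_{k∈C} ν_k e^{(2)}_k ∈ ℝ^{n_2}, where e^{(i)}_k ∈ ℝ^{n_i} is the standard unit vector at the position of the index k within I_i. Then (x, λ^{(1)}, λ^{(2)}) is a KKT pair of (P) if and only if there exists ν ∈ ℝ^C such that for i = 1,2: F_i(x^{(i)},ν) = Σ_{j=1}^{m_i} λ^{(i)}_j ∇_i g^{(i)}_j(x^{(i)}) + Σ_{j=1}^{ℓ_i} λ^{(i)}_{m_i+j} ∇_i h^{(i)}_j(x^{(i)}), h^{(i)}(x^{(i)}) = 0, and λ^{(i)}_j ≥ 0, g^{(i)}_j(x^{(i)}) ≥ 0, λ^{(i)}_j g^{(i)}_j(x^{(i)}) = 0 for all j ∈ [m_i]. -/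
open MvPolynomial Finset
open scoped Classical

noncomputable section

/-- The blockwise stationarity conditions, abstracted to vectors `a i` (objective gradients) and
`b i` (multiplier combinations) supported on `I i`: their sums agree iff the blocks agree up to a
vector supported on the overlap. -/
theorem forall_sum_eq_iff_exists_overlap {ι R : Type*} [DecidableEq ι] [CommRing R]
    (I : Fin 2 → Finset ι) (hcover : ∀ k, ∃ i, k ∈ I i) (a b : Fin 2 → ι → R)
    (ha : ∀ i, ∀ k ∉ I i, a i k = 0) (hb : ∀ i, ∀ k ∉ I i, b i k = 0) :
    (∀ k, ∑ i, a i k = ∑ i, b i k) ↔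
      ∃ ν : ι → R, ∀ i, ∀ k ∈ I i,
        a i k + (if i = 0 then (1 : R) else -1) * (if k ∈ I 0 ∩ I 1 then ν k else 0) = b i k := by
  simp only [Fin.sum_univ_two, Fin.forall_fin_two, Fin.exists_fin_two, mem_inter] at *
  constructor
  · intro hab
    refine ⟨fun k => b 0 k - a 0 k, fun k hk => ?_, fun k hk => ?_⟩
    · by_cases hk' : k ∈ I 1
      · simp [hk, hk']
      · simpa [hk', ha.2 k hk', hb.2 k hk'] using hab k
    · by_cases hk' : k ∈ I 0
      · simp only [one_ne_zero, if_false, hk, hk', and_self, if_true]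
        linear_combination hab k
      · simpa [hk', ha.1 k hk', hb.1 k hk'] using hab k
  · rintro ⟨ν, h0, h1⟩ k
    by_cases hk0 : k ∈ I 0 <;> by_cases hk1 : k ∈ I 1
    · have e0 := h0 k hk0
      have e1 := h1 k hk1
      simp only [hk0, hk1, and_self, if_true, one_ne_zero, if_false] at e0 e1
      linear_combination e0 + e1
    · simpa [hk1, ha.2 k hk1, hb.2 k hk1] using h0 k hk0
    · simpa [hk0, ha.1 k hk0, hb.1 k hk0] using h1 k hk1
    · exact absurd (hcover k) (by simp [hk0, hk1])

/-- two-block correlative sparse KKT system equivalence.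
`(x, λ^{(1)}, λ^{(2)})` is a KKT pair of (P) iff there is `ν` supported on
`C = I 0 ∩ I 1` such that the two sparse KKT systems hold. -/
theorem cs_lme_two_blocks_kkt
    (n : ℕ) (I : Fin 2 → Finset (Fin n))
    (hcover : ∀ k : Fin n, ∃ i, k ∈ I i)
    (m ℓ : Fin 2 → ℕ)
    (f : Fin 2 → MvPolynomial (Fin n) ℝ)
    (g : ∀ i, Fin (m i) → MvPolynomial (Fin n) ℝ)
    (h : ∀ i, Fin (ℓ i) → MvPolynomial (Fin n) ℝ)
    (hf : ∀ i, (f i).vars ⊆ I i)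
    (hg : ∀ i j, (g i j).vars ⊆ I i)
    (hh : ∀ i j, (h i j).vars ⊆ I i)
    (x : Fin n → ℝ) (lg : ∀ i, Fin (m i) → ℝ) (lh : ∀ i, Fin (ℓ i) → ℝ) :
    -- (x, λ) is a KKT pair of (P)
    ((∀ k : Fin n,
        (∑ i, eval x (pderiv k (f i))) =
          ∑ i, ((∑ j, lg i j * eval x (pderiv k (g i j)))
            + ∑ j, lh i j * eval x (pderiv k (h i j)))) ∧
      (∀ i, (∀ j, eval x (h i j) = 0) ∧
        (∀ j, 0 ≤ lg i j ∧ 0 ≤ eval x (g i j) ∧ lg i j * eval x (g i j) = 0)))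
    ↔
    -- there is ν ∈ ℝ^C with the two block systems (using F_1 = ∇_1 f_1 + Σ ν_k e_k,
    -- F_2 = ∇_2 f_2 − Σ ν_k e_k, written componentwise on I i)
    (∃ ν : Fin n → ℝ, ∀ i : Fin 2,
        (∀ k ∈ I i,
          eval x (pderiv k (f i))
            + (if i = 0 then (1 : ℝ) else -1) * (if k ∈ I 0 ∩ I 1 then ν k else 0) =
          (∑ j, lg i j * eval x (pderiv k (g i j)))
            + ∑ j, lh i j * eval x (pderiv k (h i j))) ∧
        (∀ j, eval x (h i j) = 0) ∧
        (∀ j, 0 ≤ lg i j ∧ 0 ≤ eval x (g i j) ∧ lg i j * eval x (g i j) = 0)) := by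
  have pderiv_zero {i : Fin 2} {p : MvPolynomial (Fin n) ℝ} (hp : p.vars ⊆ I i) {k : Fin n}
      (hk : k ∉ I i) : pderiv k p = 0 :=
    pderiv_eq_zero_of_notMem_vars fun hkp => hk (hp hkp)
  have key := forall_sum_eq_iff_exists_overlap I hcover
    (fun i k => eval x (pderiv k (f i)))
    (fun i k => (∑ j, lg i j * eval x (pderiv k (g i j)))
      + ∑ j, lh i j * eval x (pderiv k (h i j)))
    (fun i k hk => by simp [pderiv_zero (hf i) hk])
    (fun i k hk => by simp [pderiv_zero (hg i _) hk, pderiv_zero (hh i _) hk])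
  simp only [forall_and (α := Fin 2), exists_and_right]
  refine and_congr ?_ Iff.rfl
  convert key
end
end

section
/- Suppose (I_1,…,I_s) satisfies the RIP. Then (x,λ) with λ = (λ^{(1)},…,λ^{(s)}) is a KKT pair of (P) if and only if there exist values of the additional variables ν = (ν_{i,t,k})_{(i,t)∈A, k∈C_{i,t}} such that the system (S_i) holds for every i ∈ [s]. -/
open MvPolynomial Finset
open scoped Classical

noncomputable section

/-- Union of the earlier blocks `J 0, …, J (i-1)`. -/
def prevUnion {s : ℕ} {α : Type*} (J : Fin s → Finset α) (i : Fin s) : Finset α :=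
  (Finset.univ.filter (fun j => j < i)).biUnion J

/-- The arc relation produced by Algorithm 1: `(i, t)` is an arc iff `t < i`,
the intersection of `I i` with the union of the earlier blocks is nonempty and
contained in `I t`, and `t` is the largest such index. -/
def Arc {n s : ℕ} (I : Fin s → Finset (Fin n)) (i t : Fin s) : Prop :=
  t < i ∧ (I i ∩ prevUnion I i).Nonempty ∧ I i ∩ prevUnion I i ⊆ I t ∧
    ∀ t' : Fin s, t < t' → t' < i → ¬ I i ∩ prevUnion I i ⊆ I t'

/-- The running intersection property. -/
def RIP {n s : ℕ} (I : Fin s → Finset (Fin n)) : Prop :=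
  ∀ i : Fin s, 0 < (i : ℕ) → ∃ t : Fin s, t < i ∧ I i ∩ prevUnion I i ⊆ I t

/-- The edge differences of a relation for which every element of `S` has a chain of
`P`-successors down to the root `r₀` span the functions supported on `S` with total sum zero. -/
lemma exists_flow_of_sum_eq_zero {ι : Type*} [Fintype ι] [LinearOrder ι]
    (P : ι → ι → Prop) [∀ i t, Decidable (P i t)] (S : Set ι) (r₀ : ι)
    (hP : ∀ i ∈ S, i ≠ r₀ → ∃ t ∈ S, t < i ∧ P i t)
    (r : ι → ℝ) (hr : ∀ i ∉ S, r i = 0) (hsum : ∑ i, r i = 0) :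
    ∃ ν : ι → ι → ℝ, ∀ i,
      r i = (∑ t, if P i t then ν i t else 0) - ∑ t, if P t i then ν t i else 0 := by
  let D : (ι → ι → ℝ) →ₗ[ℝ] (ι → ℝ) :=
    { toFun := fun ν i => (∑ t, if P i t then ν i t else 0) - ∑ t, if P t i then ν t i else 0
      map_add' := by
        intro a b
        ext i
        simp only [Pi.add_apply, ite_add_zero, Finset.sum_add_distrib]
        ring
      map_smul' := by
        intro c a
        ext i
        simp only [Pi.smul_apply, smul_eq_mul, RingHom.id_apply, mul_sub, Finset.mul_sum,
          mul_ite, mul_zero] }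
  have hedge : ∀ i t, P i t → Pi.single i 1 - Pi.single t 1 ∈ LinearMap.range D := by
    intro i t hit
    refine ⟨fun a b => if a = i ∧ b = t then 1 else 0, ?_⟩
    ext j
    have h₁ : (∑ b, if P j b then (if j = i ∧ b = t then (1 : ℝ) else 0) else 0)
        = (Pi.single i 1 : ι → ℝ) j := by
      rw [Finset.sum_eq_single t (by intro b _ hb; simp [hb]) (by simp)]
      by_cases hj : j = i
      · subst hj; simp [hit]
      · simp [hj]
    have h₂ : (∑ b, if P b j then (if b = i ∧ j = t then (1 : ℝ) else 0) else 0)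
        = (Pi.single t 1 : ι → ℝ) j := by
      rw [Finset.sum_eq_single i (by intro b _ hb; simp [hb]) (by simp)]
      by_cases hj : j = t
      · subst hj; simp [hit]
      · simp [hj]
    exact congrArg₂ (· - ·) h₁ h₂
  have hroot : ∀ i, i ∈ S → Pi.single i 1 - Pi.single r₀ 1 ∈ LinearMap.range D := by
    intro i
    induction i using WellFoundedLT.induction with
    | ind i ih =>
      intro hi
      by_cases h0 : i = r₀
      · subst h0; simp
      · obtain ⟨t, ht, hlt, hit⟩ := hP i hi h0
        simpa using add_mem (hedge i t hit) (ih t hlt ht)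
  have hmem : ∑ i, r i • (Pi.single i 1 - Pi.single r₀ 1 : ι → ℝ) ∈ LinearMap.range D := by
    refine sum_mem fun i _ => ?_
    by_cases hi : i ∈ S
    · exact Submodule.smul_mem _ _ (hroot i hi)
    · simp [hr i hi]
  have heq : ∑ i, r i • (Pi.single i 1 - Pi.single r₀ 1 : ι → ℝ) = r := by
    simp only [smul_sub, Finset.sum_sub_distrib, ← Finset.sum_smul, hsum, zero_smul, sub_zero]
    ext j
    simp [Finset.sum_apply, Pi.single_apply]
  rw [heq] at hmem
  obtain ⟨ν, hν⟩ := hmem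
  exact ⟨ν, fun i => (congrFun hν i).symm⟩

lemma mem_prevUnion {s : ℕ} {α : Type*} {J : Fin s → Finset α} {i : Fin s} {k : α} :
    k ∈ prevUnion J i ↔ ∃ j < i, k ∈ J j := by
  simp [prevUnion]

/-- Under the RIP, every block meeting the earlier blocks has an outgoing arc. -/
lemma RIP.exists_arc {n s : ℕ} {I : Fin s → Finset (Fin n)} (hrip : RIP I) {i : Fin s}
    (hne : (I i ∩ prevUnion I i).Nonempty) : ∃ t, Arc I i t := by
  obtain ⟨k, hk⟩ := hne
  obtain ⟨j, hj, -⟩ := mem_prevUnion.1 (Finset.mem_inter.1 hk).2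
  obtain ⟨t₀, ht₀, hsub₀⟩ := hrip i (by have := Fin.lt_def.1 hj; omega)
  obtain ⟨t, ht, hmax⟩ := Finset.exists_max_image
    (Finset.univ.filter fun t => t < i ∧ I i ∩ prevUnion I i ⊆ I t) id ⟨t₀, by simp [ht₀, hsub₀]⟩
  simp only [Finset.mem_filter, Finset.mem_univ, true_and, id_eq] at ht hmax
  exact ⟨t, ht.1, ⟨k, hk⟩, ht.2, fun t' htt' ht'i hsub => (hmax t' ⟨ht'i, hsub⟩).not_gt htt'⟩

/-- Under the RIP, a family of functions on the blocks sums to zero iff it is the divergence of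
a family indexed by the arcs. -/
lemma RIP.sum_eq_zero_iff_exists_flow {n s : ℕ} {I : Fin s → Finset (Fin n)}
    (hcover : ∀ k, ∃ i, k ∈ I i) (hrip : RIP I)
    (r : Fin s → Fin n → ℝ) (hr : ∀ i, ∀ k ∉ I i, r i k = 0) :
    (∀ k, ∑ i, r i k = 0) ↔ ∃ ν : Fin s → Fin s → Fin n → ℝ, ∀ i, ∀ k ∈ I i,
      r i k = (∑ t, if Arc I i t ∧ k ∈ I i ∩ I t then ν i t k else 0)
        - ∑ t, if Arc I t i ∧ k ∈ I t ∩ I i then ν t i k else 0 := by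
  constructor
  · intro hsum
    have hflow : ∀ k, ∃ ν : Fin s → Fin s → ℝ, ∀ i,
        r i k = (∑ t, if Arc I i t ∧ k ∈ I i ∩ I t then ν i t else 0)
          - ∑ t, if Arc I t i ∧ k ∈ I t ∩ I i then ν t i else 0 := by
      intro k
      obtain ⟨i₀, hi₀⟩ := hcover k
      obtain ⟨r₀, hmem, hmin⟩ := Finset.exists_min_image
        (Finset.univ.filter fun i => k ∈ I i) id ⟨i₀, by simp [hi₀]⟩
      simp only [Finset.mem_filter, Finset.mem_univ, true_and, id_eq] at hmem hmin
      refine exists_flow_of_sum_eq_zero (fun i t => Arc I i t ∧ k ∈ I i ∩ I t)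
        {i | k ∈ I i} r₀ ?_ (fun i => r i k) (fun i hi => hr i k hi) (hsum k)
      intro i hi hne
      have hk : k ∈ I i ∩ prevUnion I i :=
        Finset.mem_inter.2 ⟨hi, mem_prevUnion.2 ⟨r₀, (hmin i hi).lt_of_ne' hne, hmem⟩⟩
      obtain ⟨t, ht⟩ := hrip.exists_arc ⟨k, hk⟩
      have hkt : k ∈ I t := ht.2.2.1 hk
      exact ⟨t, hkt, ht.1, ht, Finset.mem_inter.2 ⟨hi, hkt⟩⟩
    choose ν hν using hflow
    exact ⟨fun i t k => ν k i t, fun i k _ => hν k i⟩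
  · rintro ⟨ν, hν⟩ k
    have hall : ∀ i, r i k = (∑ t, if Arc I i t ∧ k ∈ I i ∩ I t then ν i t k else 0)
        - ∑ t, if Arc I t i ∧ k ∈ I t ∩ I i then ν t i k else 0 := by
      intro i
      by_cases hk : k ∈ I i
      · exact hν i k hk
      · simp [hr i k hk, hk]
    rw [Finset.sum_congr rfl fun i _ => hall i, Finset.sum_sub_distrib, Finset.sum_comm, sub_self]

/-- Proposition 3.1: under the RIP, `(x, λ)` is a KKT pair of (P)
iff there are values of the additional variables `ν = (ν_{i,t,k})` such that the
sparse system `(S_i)` holds for every `i`. -/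
theorem cs_lme_kkt_iff_sparse_systems
    (n s : ℕ) (I : Fin s → Finset (Fin n))
    (hcover : ∀ k : Fin n, ∃ i, k ∈ I i) (hrip : RIP I)
    (m ℓ : Fin s → ℕ)
    (f : Fin s → MvPolynomial (Fin n) ℝ)
    (g : ∀ i, Fin (m i) → MvPolynomial (Fin n) ℝ)
    (h : ∀ i, Fin (ℓ i) → MvPolynomial (Fin n) ℝ)
    (hf : ∀ i, (f i).vars ⊆ I i)
    (hg : ∀ i j, (g i j).vars ⊆ I i)
    (hh : ∀ i j, (h i j).vars ⊆ I i)
    (x : Fin n → ℝ) (lg : ∀ i, Fin (m i) → ℝ) (lh : ∀ i, Fin (ℓ i) → ℝ) :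
    -- (x, λ) is a KKT pair of (P)
    ((∀ k : Fin n,
        (∑ i, eval x (pderiv k (f i))) =
          ∑ i, ((∑ j, lg i j * eval x (pderiv k (g i j)))
            + ∑ j, lh i j * eval x (pderiv k (h i j)))) ∧
      (∀ i, (∀ j, eval x (h i j) = 0) ∧
        (∀ j, 0 ≤ lg i j ∧ 0 ≤ eval x (g i j) ∧ lg i j * eval x (g i j) = 0)))
    ↔
    -- there are additional variables ν with system (S_i) for every i, where
    -- F_i(x^{(i)}, ν^{(i)}) = ∇_i f_i − Σ_{t ∈ 𝒜_i} ν^{(i,t)} + Σ_{t ∈ 𝒟_i} ν^{(t,i)},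
    -- written componentwise on I i (C_{i,t} = I i ∩ I t)
    (∃ ν : Fin s → Fin s → Fin n → ℝ, ∀ i : Fin s,
        (∀ k ∈ I i,
          eval x (pderiv k (f i))
            - (∑ t, if Arc I i t ∧ k ∈ I i ∩ I t then ν i t k else 0)
            + (∑ t, if Arc I t i ∧ k ∈ I t ∩ I i then ν t i k else 0) =
          (∑ j, lg i j * eval x (pderiv k (g i j)))
            + ∑ j, lh i j * eval x (pderiv k (h i j))) ∧
        (∀ j, eval x (h i j) = 0) ∧
        (∀ j, 0 ≤ lg i j ∧ 0 ≤ eval x (g i j) ∧ lg i j * eval x (g i j) = 0)) := by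
  set r : Fin s → Fin n → ℝ := fun i k => eval x (pderiv k (f i)) -
    ((∑ j, lg i j * eval x (pderiv k (g i j))) + ∑ j, lh i j * eval x (pderiv k (h i j))) with hrdef
  have hr : ∀ i, ∀ k ∉ I i, r i k = 0 := by
    intro i k hk
    have hz : ∀ p : MvPolynomial (Fin n) ℝ, p.vars ⊆ I i → pderiv k p = 0 :=
      fun p hp => pderiv_eq_zero_of_notMem_vars fun hkp => hk (hp hkp)
    simp [hrdef, hz _ (hf i), hz _ (hg i _), hz _ (hh i _)]
  have key := hrip.sum_eq_zero_iff_exists_flow hcover r hr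
  simp only [hrdef, Finset.sum_sub_distrib, sub_eq_zero] at key
  rw [key]
  constructor
  · rintro ⟨⟨ν, hν⟩, hfeas⟩
    exact ⟨ν, fun i => ⟨fun k hk => by linarith [hν i k hk], hfeas i⟩⟩
  · rintro ⟨ν, hν⟩
    exact ⟨⟨ν, fun i k hk => by linarith [(hν i).1 k hk]⟩, fun i => (hν i).2⟩
end
end

section
/- Suppose (I_1,…,I_s) satisfies the RIP and Assumption 3.1 holds, with CS-LMEs p^{(i)}(x^{(i)},ν^{(i)}) := L_i(x^{(i)}) F_i(x^{(i)},ν^{(i)}). Then a vector x ∈ ℝ^n is a KKT point of (P) if and only if there exist values of the additional variables ν such that for every i ∈ [s]: F_i(x^{(i)},ν^{(i)}) = Σ_{j=1}^{m_i} p^{(i)}_j(x^{(i)},ν^{(i)}) ∇_i g^{(i)}_j(x^{(i)}) + Σ_{j=1}^{ℓ_i} p^{(i)}_{m_i+j}(x^{(i)},ν^{(i)}) ∇_i h^{(i)}_j(x^{(i)}); h^{(i)}(x^{(i)}) = 0; and p^{(i)}_j(x^{(i)},ν^{(i)}) ≥ 0, g^{(i)}_j(x^{(i)}) ≥ 0,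 p^{(i)}_j(x^{(i)},ν^{(i)}) g^{(i)}_j(x^{(i)}) = 0 for all j ∈ [m_i]. -/
open MvPolynomial Finset
open scoped Classical

noncomputable section

/-- The vector `F_i(x^{(i)}, ν^{(i)})`, written componentwise:
`F_i = ∇_i f_i − Σ_{t ∈ 𝒜_i} ν^{(i,t)} + Σ_{t ∈ 𝒟_i} ν^{(t,i)}` (here `C_{i,t} = I i ∩ I t`). -/
def Fval {n s : ℕ} (I : Fin s → Finset (Fin n)) (f : Fin s → MvPolynomial (Fin n) ℝ)
    (x : Fin n → ℝ) (ν : Fin s → Fin s → Fin n → ℝ) (i : Fin s) (k : Fin n) : ℝ :=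
  eval x (pderiv k (f i))
    - (∑ t, if Arc I i t ∧ k ∈ I i ∩ I t then ν i t k else 0)
    + (∑ t, if Arc I t i ∧ k ∈ I t ∩ I i then ν t i k else 0)

/-- The correlative sparse Lagrange multiplier expression
`p^{(i)}(x^{(i)}, ν^{(i)}) = L_i(x^{(i)}) F_i(x^{(i)}, ν^{(i)})`, evaluated at `(x, ν)`. -/
def pval {n s : ℕ} (I : Fin s → Finset (Fin n)) (f : Fin s → MvPolynomial (Fin n) ℝ)
    {mh : Fin s → ℕ} (L : ∀ i, Fin (mh i) → Fin n → MvPolynomial (Fin n) ℝ)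
    (x : Fin n → ℝ) (ν : Fin s → Fin s → Fin n → ℝ) (i : Fin s) (j : Fin (mh i)) : ℝ :=
  ∑ k ∈ I i, eval x (L i j k) * Fval I f x ν i k

/-- Flow values on a forest can be chosen, from the leaves down, to satisfy
`w i = a i + (sum of the values of the children of i)`. -/
theorem exists_eq_add_sum_children {s : ℕ} (R : Fin s → Fin s → Prop)
    [∀ i t, Decidable (R i t)]
    (hlt : ∀ i t, R i t → t < i) (a : Fin s → ℝ) :
    ∃ w : Fin s → ℝ, ∀ i, w i = a i + ∑ t, if R t i then w t else 0 := by
  have hwf : WellFounded (fun i j : Fin s => i > j) := wellFounded_gt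
  refine ⟨hwf.fix fun i w => a i + ∑ t, if h : R t i then w t (hlt t i h) else 0, fun i => ?_⟩
  conv_lhs => rw [hwf.fix_eq]
  simp only [dite_eq_ite]

/-- A demand with total zero, supported on a set `S` that a parent relation `R` makes into a
rooted tree, is met by a flow along the arcs of `R`. -/
theorem exists_flow_of_sum_eq_zero_s5 {s : ℕ} (R : Fin s → Fin s → Prop)
    [∀ i t, Decidable (R i t)] (S : Finset (Fin s))
    (hlt : ∀ i t, R i t → t < i) (huniq : ∀ i t t', R i t → R i t' → t = t')
    (hRS : ∀ i t, R i t → t ∈ S)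
    (hpar : ∀ i ∈ S, ∀ j ∈ S, j < i → ∃ t, R i t)
    (a : Fin s → ℝ) (ha : ∀ i, i ∉ S → a i = 0) (hsum : ∑ i, a i = 0) :
    ∃ w : Fin s → ℝ, ∀ i ∈ S,
      a i = (∑ t, if R i t then w i else 0) - ∑ t, if R t i then w t else 0 := by
  obtain ⟨w, hw⟩ := exists_eq_add_sum_children R hlt a
  refine ⟨w, fun i hi => ?_⟩
  have hb : ∀ j, (∃ t, R j t) → (∑ t, if R j t then w j else 0) = w j := by
    rintro j ⟨t, ht⟩
    rw [Finset.sum_eq_single t (fun t' _ h => if_neg fun h' => h (huniq j _ _ h' ht))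
      (fun h => absurd (Finset.mem_univ t) h), if_pos ht]
  suffices h : w i = ∑ t, if R i t then w i else 0 by
    rw [← h]
    linarith [hw i]
  by_cases hex : ∃ t, R i t
  · exact (hb i hex).symm
  have htot : ∑ j, (w j - ∑ t, if R j t then w j else 0) = 0 := by
    rw [Finset.sum_sub_distrib, Finset.sum_comm (f := fun j t => if R j t then w j else 0),
      ← Finset.sum_sub_distrib]
    refine Eq.trans ?_ hsum
    exact Finset.sum_congr rfl fun j _ => by linarith [hw j]
  rw [Finset.sum_eq_single i ?_ (fun h => absurd (Finset.mem_univ i) h)] at htot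
  · linarith
  intro j _ hji
  by_cases hj : j ∈ S
  · have : ∃ t, R j t := by
      rcases lt_or_gt_of_ne hji with h | h
      · exact absurd (hpar i hi j hj h) hex
      · exact hpar j hj i hi h
    rw [hb j this, sub_self]
  · have hwj : w j = 0 := by
      rw [hw j, ha j hj, zero_add]
      exact Finset.sum_eq_zero fun t _ => if_neg fun h => hj (hRS t j h)
    simp [hwj]

section Arcs

variable {n s : ℕ} {I : Fin s → Finset (Fin n)}

theorem mem_prevUnion_iff {i : Fin s} {k : Fin n} :
    k ∈ prevUnion I i ↔ ∃ j, j < i ∧ k ∈ I j := by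
  simp [prevUnion]

theorem Arc.unique {i t t' : Fin s} (h : Arc I i t) (h' : Arc I i t') : t = t' := by
  rcases lt_trichotomy t t' with hlt | heq | hgt
  · exact absurd h'.2.2.1 (h.2.2.2 t' hlt h'.1)
  · exact heq
  · exact absurd h.2.2.1 (h'.2.2.2 t hgt h.1)

theorem RIP.exists_arc_s5 (hrip : RIP I) {i j : Fin s} {k : Fin n} (hji : j < i)
    (hi : k ∈ I i) (hj : k ∈ I j) : ∃ t, Arc I i t ∧ k ∈ I i ∩ I t := by
  have hk : k ∈ I i ∩ prevUnion I i :=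
    Finset.mem_inter.2 ⟨hi, mem_prevUnion_iff.2 ⟨j, hji, hj⟩⟩
  obtain ⟨t₀, ht₀⟩ := hrip i (lt_of_le_of_lt (Nat.zero_le _) hji)
  let T := Finset.univ.filter fun t : Fin s => t < i ∧ I i ∩ prevUnion I i ⊆ I t
  have hT : T.Nonempty := ⟨t₀, by simpa [T] using ht₀⟩
  have hmem : T.max' hT < i ∧ I i ∩ prevUnion I i ⊆ I (T.max' hT) := by
    simpa [T] using T.max'_mem hT
  refine ⟨T.max' hT, ⟨hmem.1, ⟨k, hk⟩, hmem.2, fun t' hlt hti hsub => ?_⟩,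
    Finset.mem_inter.2 ⟨hi, hmem.2 hk⟩⟩
  exact absurd (T.le_max' t' (Finset.mem_filter.2 ⟨Finset.mem_univ _, hti, hsub⟩)) (not_le.2 hlt)

/-- The multiplier contributions in the `Fval` cancel when summed over all blocks. -/
theorem sum_Fval (f : Fin s → MvPolynomial (Fin n) ℝ) (x : Fin n → ℝ)
    (ν : Fin s → Fin s → Fin n → ℝ) (k : Fin n) :
    ∑ i, Fval I f x ν i k = ∑ i, eval x (pderiv k (f i)) := by
  simp only [Fval, Finset.sum_add_distrib, Finset.sum_sub_distrib]
  rw [Finset.sum_comm (f := fun i t => if Arc I t i ∧ k ∈ I t ∩ I i then ν t i k else 0)]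
  ring

theorem Fval_of_notMem (f : Fin s → MvPolynomial (Fin n) ℝ) (x : Fin n → ℝ)
    (ν : Fin s → Fin s → Fin n → ℝ) {i : Fin s} {k : Fin n} (hk : k ∉ I i) :
    Fval I f x ν i k = eval x (pderiv k (f i)) := by
  simp [Fval, hk]

/-- Block gradients with prescribed total can be attained by a choice of `ν`. -/
theorem RIP.exists_Fval_eq (hrip : RIP I) {f : Fin s → MvPolynomial (Fin n) ℝ}
    (hf : ∀ i, (f i).vars ⊆ I i) (x : Fin n → ℝ) (b : Fin s → Fin n → ℝ)
    (hb : ∀ i k, k ∉ I i → b i k = 0)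
    (hsum : ∀ k, ∑ i, eval x (pderiv k (f i)) = ∑ i, b i k) :
    ∃ ν : Fin s → Fin s → Fin n → ℝ, ∀ i, ∀ k ∈ I i, Fval I f x ν i k = b i k := by
  have key : ∀ k, ∃ w : Fin s → ℝ, ∀ i ∈ Finset.univ.filter (fun i => k ∈ I i),
      eval x (pderiv k (f i)) - b i k =
        (∑ t, if Arc I i t ∧ k ∈ I i ∩ I t then w i else 0) -
          ∑ t, if Arc I t i ∧ k ∈ I t ∩ I i then w t else 0 := by
    intro k
    refine exists_flow_of_sum_eq_zero_s5 (fun i t => Arc I i t ∧ k ∈ I i ∩ I t) _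
      (fun i t h => h.1.1) (fun i t t' h h' => h.1.unique h'.1) (fun i t h => ?_)
      (fun i hi j hj hji => ?_) (fun i => eval x (pderiv k (f i)) - b i k) (fun i hi => ?_) ?_
    · simpa using (Finset.mem_inter.1 h.2).2
    · exact hrip.exists_arc_s5 hji (Finset.mem_filter.1 hi).2 (Finset.mem_filter.1 hj).2
    · have hk : k ∉ I i := by simpa using hi
      simp [pderiv_eq_zero_of_notMem_vars fun h => hk (hf i h), hb i k hk]
    · rw [Finset.sum_sub_distrib, hsum k, sub_self]
  choose w hw using key
  refine ⟨fun i _ k => w k i, fun i k hk => ?_⟩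
  have := hw k i (by simpa using hk)
  simp only [Fval]
  linarith

/-- A left inverse of the constraint matrix recovers complementary multipliers. -/
theorem pval_eq_of_Fval_eq {f : Fin s → MvPolynomial (Fin n) ℝ} {mh : Fin s → ℕ}
    {c : ∀ i, Fin (mh i) → MvPolynomial (Fin n) ℝ}
    {L : ∀ i, Fin (mh i) → Fin n → MvPolynomial (Fin n) ℝ}
    {D : ∀ i, Fin (mh i) → Fin (mh i) → MvPolynomial (Fin n) ℝ} {i : Fin s}
    (hLD : ∀ j j' : Fin (mh i),
      (∑ k ∈ I i, L i j k * pderiv k (c i j')) + D i j j' * c i j' = if j = j' then 1 else 0)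
    {x : Fin n → ℝ} {ν : Fin s → Fin s → Fin n → ℝ} {lam : Fin (mh i) → ℝ}
    (hF : ∀ k ∈ I i, Fval I f x ν i k = ∑ j, lam j * eval x (pderiv k (c i j)))
    (hcompl : ∀ j, lam j * eval x (c i j) = 0) (j : Fin (mh i)) :
    pval I f L x ν i j = lam j := by
  have hev : ∀ j', lam j' * ∑ k ∈ I i, eval x (L i j k) * eval x (pderiv k (c i j')) =
      if j = j' then lam j' else 0 := by
    intro j'
    have h := congrArg (eval x) (hLD j j')
    simp only [map_add, map_sum, map_mul, apply_ite (eval x), map_one, map_zero] at h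
    have h' := congrArg (lam j' * ·) h
    simp only [mul_ite, mul_one, mul_zero] at h'
    rw [← h']
    linear_combination (-eval x (D i j j')) * hcompl j'
  calc pval I f L x ν i j
      = ∑ k ∈ I i, ∑ j', lam j' * (eval x (L i j k) * eval x (pderiv k (c i j'))) := by
        refine Finset.sum_congr rfl fun k hk => ?_
        rw [hF k hk, Finset.mul_sum]
        exact Finset.sum_congr rfl fun j' _ => by ring
    _ = ∑ j', if j = j' then lam j' else 0 := by
        rw [Finset.sum_comm]
        exact Finset.sum_congr rfl fun j' _ => by rw [← Finset.mul_sum, hev]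
    _ = lam j := by simp

end Arcs

/-- Theorem 3.1: under the RIP and Assumption 3.1 (with CS-LMEs
`p^{(i)} = L_i F_i`), `x` is a KKT point of (P) iff there are values of the
additional variables `ν` such that for every `i` the system (S_i) holds with
`λ^{(i)}` replaced by `p^{(i)}(x^{(i)}, ν^{(i)})`.  The constraints of block `i`
are `c i`, with `g^{(i)}_j = c i (castAdd j)` and `h^{(i)}_j = c i (natAdd j)`. -/
theorem cs_lme_kkt_point_iff
    (n s : ℕ) (I : Fin s → Finset (Fin n))
    (hcover : ∀ k : Fin n, ∃ i, k ∈ I i) (hrip : RIP I)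
    (m ℓ : Fin s → ℕ)
    (f : Fin s → MvPolynomial (Fin n) ℝ)
    (c : ∀ i, Fin (m i + ℓ i) → MvPolynomial (Fin n) ℝ)
    (hf : ∀ i, (f i).vars ⊆ I i) (hc : ∀ i j, (c i j).vars ⊆ I i)
    -- Assumption 3.1: [L_i D_i] G_i = Identity, with L_i, D_i polynomial in x^{(i)}
    (L : ∀ i, Fin (m i + ℓ i) → Fin n → MvPolynomial (Fin n) ℝ)
    (D : ∀ i, Fin (m i + ℓ i) → Fin (m i + ℓ i) → MvPolynomial (Fin n) ℝ)
    (hL : ∀ i j k, (L i j k).vars ⊆ I i) (hD : ∀ i j j', (D i j j').vars ⊆ I i)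
    (hLD : ∀ i (j j' : Fin (m i + ℓ i)),
      (∑ k ∈ I i, L i j k * pderiv k (c i j')) + D i j j' * c i j'
        = if j = j' then 1 else 0)
    (x : Fin n → ℝ) :
    -- x is a KKT point of (P)
    (∃ lam : ∀ i, Fin (m i + ℓ i) → ℝ,
      (∀ k : Fin n, (∑ i, eval x (pderiv k (f i))) =
          ∑ i, ∑ j, lam i j * eval x (pderiv k (c i j))) ∧
      (∀ i, (∀ j : Fin (ℓ i), eval x (c i (Fin.natAdd (m i) j)) = 0) ∧
        (∀ j : Fin (m i), 0 ≤ lam i (Fin.castAdd (ℓ i) j)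
          ∧ 0 ≤ eval x (c i (Fin.castAdd (ℓ i) j))
          ∧ lam i (Fin.castAdd (ℓ i) j) * eval x (c i (Fin.castAdd (ℓ i) j)) = 0)))
    ↔
    (∃ ν : Fin s → Fin s → Fin n → ℝ, ∀ i : Fin s,
      (∀ k ∈ I i,
        Fval I f x ν i k =
          ∑ j, pval I f L x ν i j * eval x (pderiv k (c i j))) ∧
      (∀ j : Fin (ℓ i), eval x (c i (Fin.natAdd (m i) j)) = 0) ∧
      (∀ j : Fin (m i), 0 ≤ pval I f L x ν i (Fin.castAdd (ℓ i) j)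
        ∧ 0 ≤ eval x (c i (Fin.castAdd (ℓ i) j))
        ∧ pval I f L x ν i (Fin.castAdd (ℓ i) j)
            * eval x (c i (Fin.castAdd (ℓ i) j)) = 0)) := by
  have hc0 : ∀ i j k, k ∉ I i → pderiv k (c i j) = 0 := fun i j k hk =>
    pderiv_eq_zero_of_notMem_vars fun h => hk (hc i j h)
  constructor
  · rintro ⟨lam, hgrad, hcon⟩
    obtain ⟨ν, hν⟩ := hrip.exists_Fval_eq hf x
      (fun i k => ∑ j, lam i j * eval x (pderiv k (c i j)))
      (fun i k hk => by simp [hc0 i _ k hk]) hgrad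
    have hcompl : ∀ i j, lam i j * eval x (c i j) = 0 := by
      intro i j
      induction j using Fin.addCases with
      | left j => exact ((hcon i).2 j).2.2
      | right j => rw [(hcon i).1 j, mul_zero]
    have hp : ∀ i j, pval I f L x ν i j = lam i j := fun i j =>
      pval_eq_of_Fval_eq (mh := fun i => m i + ℓ i) (c := c) (L := L) (D := D)
        (hLD i) (hν i) (hcompl i) j
    refine ⟨ν, fun i => ?_⟩
    simp only [hp]
    exact ⟨hν i, hcon i⟩
  · rintro ⟨ν, hν⟩
    refine ⟨fun i j => pval I f L x ν i j, fun k => ?_, fun i => (hν i).2⟩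
    rw [← sum_Fval (I := I) f x ν k]
    refine Finset.sum_congr rfl fun i _ => ?_
    by_cases hk : k ∈ I i
    · exact (hν i).1 k hk
    · rw [Fval_of_notMem f x ν hk, pderiv_eq_zero_of_notMem_vars fun h => hk (hf i h)]
      simp [hc0 i _ k hk]
end
end

section
/- Fix i ∈ [s] and suppose Assumption 3.1 holds for block i, with CS-LME p^{(i)}(x^{(i)},ν^{(i)}) := L_i(x^{(i)}) F_i(x^{(i)},ν^{(i)}). Then for all values of (x^{(i)}, λ^{(i)}, ν^{(i)}), the system (S_i) holds if and only if λ^{(i)} = p^{(i)}(x^{(i)},ν^{(i)}) and the system obtained from (S_i) by replacing each λ^{(i)}_j with p^{(i)}_j(x^{(i)},ν^{(i)}) holds, namely: F_i(x^{(i)},ν^{(i)}) = Σ_{j=1}^{m_i} p^{(i)}_j(x^{(i)},ν^{(i)}) ∇_i g^{(i)}_j(x^{(i)}) + Σ_{j=1}^{ℓ_i} p^{(i)}_{m_i+j}(x^{(i)},ν^{(i)}) ∇_i h^{(i)}_j(x^{(i)}); h^{(i)}(x^{(i)}) = 0; and p^{(i)}_j(x^{(i)},ν^{(i)}) ≥ 0,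 g^{(i)}_j(x^{(i)}) ≥ 0, p^{(i)}_j(x^{(i)},ν^{(i)}) g^{(i)}_j(x^{(i)}) = 0 for all j ∈ [m_i]. -/
open MvPolynomial Finset
open scoped Classical

noncomputable section

/-- If `L` and `D` form a left inverse of the constraint matrix of `c` at block `S`, any multiplier
`lam` that solves the stationarity equation `F = ∑ j, lam j • ∇ c j` and satisfies complementarity
is recovered as `L F`. -/
theorem multiplier_eq_of_stationary {σ ι R : Type*} [CommRing R] [Fintype ι] [DecidableEq ι]
    (S : Finset σ) (c : ι → MvPolynomial σ R) (L : ι → σ → MvPolynomial σ R)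
    (D : ι → ι → MvPolynomial σ R)
    (hLD : ∀ j j', (∑ k ∈ S, L j k * pderiv k (c j')) + D j j' * c j' = if j = j' then 1 else 0)
    (x : σ → R) (lam : ι → R) (F : σ → R)
    (hF : ∀ k ∈ S, F k = ∑ j, lam j * eval x (pderiv k (c j)))
    (hcompl : ∀ j, lam j * eval x (c j) = 0) (j : ι) :
    lam j = ∑ k ∈ S, eval x (L j k) * F k := by
  have hev : ∀ j', (∑ k ∈ S, eval x (L j k) * eval x (pderiv k (c j')))
      + eval x (D j j') * eval x (c j') = if j = j' then 1 else 0 := fun j' => by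
    have h := congrArg (eval x) (hLD j j')
    rw [map_add, map_sum, apply_ite (eval x), map_one, map_zero] at h
    simpa only [map_mul] using h
  calc lam j = ∑ j', lam j' * (if j = j' then 1 else 0) := by simp
    _ = ∑ j', ∑ k ∈ S, eval x (L j k) * (lam j' * eval x (pderiv k (c j'))) := by
        refine Finset.sum_congr rfl fun j' _ => ?_
        rw [← hev j', mul_add, mul_left_comm, hcompl j', mul_zero, add_zero, Finset.mul_sum]
        exact Finset.sum_congr rfl fun k _ => mul_left_comm _ _ _
    _ = ∑ k ∈ S, eval x (L j k) * F k := by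
        rw [Finset.sum_comm]
        refine Finset.sum_congr rfl fun k hk => ?_
        rw [hF k hk, Finset.mul_sum]

/-- fix a block `i` and suppose Assumption 3.1 holds for it, with
CS-LME `p^{(i)} = L_i F_i`.  Then, for all `(x, λ^{(i)}, ν)`, the system `(S_i)`
holds iff `λ^{(i)} = p^{(i)}(x^{(i)}, ν^{(i)})` and the system obtained from
`(S_i)` by substituting `p^{(i)}` for `λ^{(i)}` holds.  The constraints of
block `i` are `c i`, with `g^{(i)}_j = c i (castAdd j)`, `h^{(i)}_j = c i (natAdd j)`. -/
theorem cs_lme_block_system_iff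
    (n s : ℕ) (I : Fin s → Finset (Fin n))
    (m ℓ : Fin s → ℕ)
    (f : Fin s → MvPolynomial (Fin n) ℝ)
    (c : ∀ i, Fin (m i + ℓ i) → MvPolynomial (Fin n) ℝ)
    (hf : ∀ i, (f i).vars ⊆ I i) (hc : ∀ i j, (c i j).vars ⊆ I i)
    (i : Fin s)
    (L : ∀ i, Fin (m i + ℓ i) → Fin n → MvPolynomial (Fin n) ℝ)
    (D : ∀ i, Fin (m i + ℓ i) → Fin (m i + ℓ i) → MvPolynomial (Fin n) ℝ)
    (hL : ∀ j k, (L i j k).vars ⊆ I i) (hD : ∀ j j', (D i j j').vars ⊆ I i)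
    (hLD : ∀ j j' : Fin (m i + ℓ i),
      (∑ k ∈ I i, L i j k * pderiv k (c i j')) + D i j j' * c i j'
        = if j = j' then 1 else 0)
    (x : Fin n → ℝ) (lam : Fin (m i + ℓ i) → ℝ) (ν : Fin s → Fin s → Fin n → ℝ) :
    -- the system (S_i) with multipliers λ^{(i)}
    ((∀ k ∈ I i,
        Fval I f x ν i k = ∑ j, lam j * eval x (pderiv k (c i j))) ∧
      (∀ j : Fin (ℓ i), eval x (c i (Fin.natAdd (m i) j)) = 0) ∧
      (∀ j : Fin (m i), 0 ≤ lam (Fin.castAdd (ℓ i) j)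
        ∧ 0 ≤ eval x (c i (Fin.castAdd (ℓ i) j))
        ∧ lam (Fin.castAdd (ℓ i) j) * eval x (c i (Fin.castAdd (ℓ i) j)) = 0))
    ↔
    -- λ^{(i)} = p^{(i)}(x^{(i)}, ν^{(i)}) and the system (S_i) with p^{(i)} substituted
    ((∀ j, lam j = pval I f L x ν i j) ∧
      (∀ k ∈ I i,
        Fval I f x ν i k = ∑ j, pval I f L x ν i j * eval x (pderiv k (c i j))) ∧
      (∀ j : Fin (ℓ i), eval x (c i (Fin.natAdd (m i) j)) = 0) ∧
      (∀ j : Fin (m i), 0 ≤ pval I f L x ν i (Fin.castAdd (ℓ i) j)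
        ∧ 0 ≤ eval x (c i (Fin.castAdd (ℓ i) j))
        ∧ pval I f L x ν i (Fin.castAdd (ℓ i) j)
            * eval x (c i (Fin.castAdd (ℓ i) j)) = 0)) := by
  constructor
  · rintro ⟨hF, hh, hg⟩
    have hcompl : ∀ j, lam j * eval x (c i j) = 0 :=
      Fin.addCases (fun j => (hg j).2.2) fun j => by rw [hh j, mul_zero]
    have hlam : lam = pval I f L x ν i := funext fun j =>
      multiplier_eq_of_stationary (I i) (c i) (L i) (D i)
        (fun j j' => by convert hLD j j') x lam _ hF hcompl j
    subst hlam
    exact ⟨fun _ => rfl, hF, hh, hg⟩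
  · rintro ⟨hlam, h⟩
    obtain rfl := funext hlam
    exact h
end
end

section
/- Suppose (I_1,…,I_s) satisfies the RIP. Then for every i ∈ [s−1]: 𝒥_{i+1} ∩ (𝒥_1 ∪ … ∪ 𝒥_i) ⊆ {(i+1,t,k) : t ∈ 𝒜_{i+1}, k ∈ C_{i+1,t}}. -/
open MvPolynomial Finset
open scoped Classical

noncomputable section

/-- The index set `𝒥_i = {(i,t,k) : t ∈ 𝒜_i, k ∈ C_{i,t}} ∪ {(t,i,k) : t ∈ 𝒟_i, k ∈ C_{t,i}}`
of the additional variables attached to block `i`. -/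
def Jset {n s : ℕ} (I : Fin s → Finset (Fin n)) (i : Fin s) :
    Finset (Fin s × Fin s × Fin n) :=
  Finset.univ.filter (fun q => (q.1 = i ∨ q.2.1 = i) ∧ Arc I q.1 q.2.1 ∧
    q.2.2 ∈ I q.1 ∩ I q.2.1)

/-- The enlarged block `hat I_i`: the disjoint union of `I i` and `𝒥_i`
(two disjoint sorts, realized as a sum type). -/
def hatI {n s : ℕ} (I : Fin s → Finset (Fin n)) (i : Fin s) :
    Finset (Fin n ⊕ (Fin s × Fin s × Fin n)) :=
  (I i).map ⟨Sum.inl, Sum.inl_injective⟩ ∪ (Jset I i).map ⟨Sum.inr, Sum.inr_injective⟩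

/-- under the RIP, for every block `b` other than the first,
`𝒥_b ∩ (𝒥_1 ∪ … ∪ 𝒥_{b-1}) ⊆ {(b,t,k) : t ∈ 𝒜_b, k ∈ C_{b,t}}`. -/
theorem Jset_inter_prev_subset
    (n s : ℕ) (I : Fin s → Finset (Fin n)) (hrip : RIP I) :
    ∀ b : Fin s, 0 < (b : ℕ) →
      Jset I b ∩ prevUnion (Jset I) b ⊆
        Finset.univ.filter (fun q : Fin s × Fin s × Fin n =>
          q.1 = b ∧ Arc I q.1 q.2.1 ∧ q.2.2 ∈ I q.1 ∩ I q.2.1) := by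
  intro b _ q hq
  simp only [Jset, prevUnion, mem_inter, mem_biUnion, mem_filter, mem_univ, true_and] at hq ⊢
  obtain ⟨⟨hb, harc, hk⟩, j, hj, hqj, -⟩ := hq
  have hlt : q.2.1 < q.1 := harc.1
  refine ⟨?_, harc, hk⟩
  grind
end
end
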